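/- arXiv:2509.17967 — 4 statements merged into one kernel-verified Lean document; each statement's English description precedes it below -/
import Mathlib

section
/- Let d ≥ 1 and let ρ₁, …, ρₙ be density matrices on ℂ^d (positive semidefinite complex d×d matrices of trace 1). If ρ₁, …, ρₙ are linearly independent as elements of the complex vector space of d×d matrices, then the family {ρᵢ} is Spekkens noncontextual. -/
open scoped ComplexOrder

/-- A finite family of density matrices `ρᵢ` on `ℂ^d` is Spekkens noncontextual if there
exist finitely many Hermitian matrices `G_λ` summing to the identity and density matrices
`σ_λ` such that `Tr(ρᵢ G_λ) ≥ 0` and the Born rule probabilities factor through the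
ontological model: `Tr(ρᵢ M) = Σ_λ Tr(ρᵢ G_λ) Tr(σ_λ M)` for every PSD matrix `M`. -/
def SpekkensNoncontextual {d n : ℕ} (ρ : Fin n → Matrix (Fin d) (Fin d) ℂ) : Prop :=
  ∃ (L : ℕ) (G σ : Fin L → Matrix (Fin d) (Fin d) ℂ),
    (∀ l, (G l).IsHermitian) ∧
    (∑ l, G l = 1) ∧
    (∀ l, (σ l).PosSemidef ∧ (σ l).trace = 1) ∧
    (∀ i l, 0 ≤ (ρ i * G l).trace) ∧
    (∀ M : Matrix (Fin d) (Fin d) ℂ, M.PosSemidef →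
      ∀ i, (ρ i * M).trace = ∑ l, (ρ i * G l).trace * (σ l * M).trace)

/-- Every linear functional on square matrices has the form `X ↦ Tr(X A)`. -/
theorem exists_trace_mul_eq {m R : Type*} [Fintype m] [DecidableEq m] [CommSemiring R]
    (f : Matrix m m R →ₗ[R] R) : ∃ A : Matrix m m R, ∀ X, (X * A).trace = f X := by
  refine ⟨Matrix.of fun k i => f (Matrix.single i k 1), fun X => ?_⟩
  conv_rhs => rw [Matrix.matrix_eq_sum_single X]
  simp only [map_sum, Matrix.trace, Matrix.diag, Matrix.mul_apply, Matrix.of_apply]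
  refine Finset.sum_congr rfl fun i _ => Finset.sum_congr rfl fun k _ => ?_
  rw [← smul_eq_mul, ← map_smul, Matrix.smul_single, smul_eq_mul, mul_one]

/-- A linearly independent family of Hermitian matrices has a Hermitian dual family with respect
to the trace pairing. -/
theorem exists_isHermitian_trace_dual {m ι : Type*} [Fintype m] [DecidableEq m] [DecidableEq ι]
    {ρ : ι → Matrix m m ℂ} (hρ : ∀ i, (ρ i).IsHermitian) (hlin : LinearIndependent ℂ ρ) :
    ∃ G : ι → Matrix m m ℂ, (∀ j, (G j).IsHermitian) ∧
      ∀ i j, (ρ i * G j).trace = if i = j then 1 else 0 := by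
  obtain ⟨g, hg⟩ := LinearMap.exists_leftInverse_of_injective
    (Finsupp.linearCombination ℂ ρ) (LinearMap.ker_eq_bot.2 hlin)
  have hgρ : ∀ i, g (ρ i) = Finsupp.single i 1 := fun i => by
    simpa using LinearMap.congr_fun hg (Finsupp.single i 1)
  choose A hA using fun j => exists_trace_mul_eq (Finsupp.lapply j ∘ₗ g)
  have hAρ : ∀ i j, (ρ i * A j).trace = if i = j then 1 else 0 := fun i j => by
    simp [hA, hgρ, Finsupp.single_apply]
  have hAρ' : ∀ i j, (ρ i * (A j).conjTranspose).trace = if i = j then 1 else 0 := fun i j => by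
    have h := Matrix.trace_conjTranspose (ρ i * A j)
    rw [Matrix.conjTranspose_mul, (hρ i).eq, Matrix.trace_mul_comm, hAρ] at h
    rw [h]
    split_ifs <;> simp
  refine ⟨fun j => (1 / 2 : ℝ) • (A j + (A j).conjTranspose), fun j => ?_, fun i j => ?_⟩
  · simp [Matrix.IsHermitian, Matrix.conjTranspose_smul, add_comm]
  · rw [Matrix.mul_smul, Matrix.trace_smul, Matrix.mul_add, Matrix.trace_add, hAρ, hAρ']
    split_ifs
    · norm_num [Complex.ext_iff]
    · simp

/-- In positive dimension the maximally mixed state is a density matrix. -/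
theorem exists_posSemidef_trace_eq_one {m : Type*} [Fintype m] [DecidableEq m] [Nonempty m] :
    ∃ τ : Matrix m m ℂ, τ.PosSemidef ∧ τ.trace = 1 := by
  refine ⟨((Fintype.card m : ℂ)⁻¹) • 1, Matrix.PosSemidef.one.smul (by positivity), ?_⟩
  simp [Matrix.trace_smul]

/-- Linearly independent density matrices are Spekkens noncontextual. -/
theorem linearIndependent_imp_spekkensNoncontextual {d n : ℕ} (hd : 1 ≤ d)
    (ρ : Fin n → Matrix (Fin d) (Fin d) ℂ)
    (hρ : ∀ i, (ρ i).PosSemidef ∧ (ρ i).trace = 1)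
    (hlin : LinearIndependent ℂ ρ) :
    SpekkensNoncontextual ρ := by
  have : Nonempty (Fin d) := ⟨⟨0, hd⟩⟩
  obtain ⟨G, hG, hdual⟩ := exists_isHermitian_trace_dual (fun i => (hρ i).1.isHermitian) hlin
  obtain ⟨τ, hτ⟩ := exists_posSemidef_trace_eq_one (m := Fin d)
  have hrest : ∀ i, (ρ i * (1 - ∑ j, G j)).trace = 0 := fun i => by
    simp [Matrix.mul_sub, Matrix.mul_sum, Matrix.trace_sum, hdual, (hρ i).2]
  refine ⟨n + 1, Fin.cons (1 - ∑ j, G j) G, Fin.cons τ ρ, ?_, ?_, ?_, ?_, ?_⟩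
  · refine Fin.cases ?_ fun j => ?_
    · exact Matrix.isHermitian_one.sub (isSelfAdjoint_sum _ fun j _ => hG j)
    · exact hG j
  · simp [Fin.sum_univ_succ]
  · exact Fin.cases hτ hρ
  · refine fun i => Fin.cases ?_ fun j => ?_
    · exact (hrest i).ge
    · rw [Fin.cons_succ, hdual]
      split_ifs <;> simp
  · intro M _ i
    simp [Fin.sum_univ_succ, hrest, hdual]
end

section
/- In ℂ², let ρ₁ = |0⟩⟨0|, ρ₂ = |1⟩⟨1|, ρ₃ = |+⟩⟨+|, ρ₄ = |−⟩⟨−|, where |±⟩ = (|0⟩ ± |1⟩)/√2 and |0⟩, |1⟩ is the standard basis. Then ρ₁ + ρ₂ = ρ₃ + ρ₄ = I, so the four density matrices are linearly dependent, and consequently the family {ρ₁, ρ₂, ρ₃, ρ₄} is NOT Spekkens noncontextual (it is contextual). -/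
open scoped ComplexOrder

/-- A decomposed Born probability that is zero has only zero terms. -/
lemma trace_mul_trace_eq_zero {d L : ℕ} {A M : Matrix (Fin d) (Fin d) ℂ}
    {G σ : Fin L → Matrix (Fin d) (Fin d) ℂ}
    (hG : ∀ l, 0 ≤ (A * G l).trace) (hσ : ∀ l, 0 ≤ (σ l * M).trace)
    (h : (A * M).trace = ∑ l, (A * G l).trace * (σ l * M).trace)
    (h0 : (A * M).trace = 0) (l : Fin L) : (A * G l).trace * (σ l * M).trace = 0 :=
  (Finset.sum_eq_zero_iff_of_nonneg fun l _ => mul_nonneg (hG l) (hσ l)).1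
    (h.symm.trans h0) l (Finset.mem_univ l)

lemma trace_mul_vecMulVec_star_nonneg {n : Type*} [Fintype n] {A : Matrix n n ℂ}
    (hA : A.PosSemidef) (v : n → ℂ) : 0 ≤ (A * Matrix.vecMulVec v (star v)).trace := by
  rw [Matrix.mul_vecMulVec, Matrix.trace_vecMulVec, dotProduct_comm]
  exact hA.dotProduct_mulVec_nonneg v

/-- A positive semidefinite `2 × 2` matrix with zero lower right entry is diagonal. -/
lemma Matrix.PosSemidef.offDiag_eq_zero {A : Matrix (Fin 2) (Fin 2) ℂ} (hA : A.PosSemidef)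
    (h : A 1 1 = 0) : A 0 1 = 0 ∧ A 1 0 = 0 := by
  have hz : A.mulVec ![0, 1] = 0 := (hA.dotProduct_mulVec_zero_iff ![0, 1]).1 (by
    simp [Matrix.mulVec, dotProduct, Fin.sum_univ_two, h])
  have h01 : A 0 1 = 0 := by
    simpa [Matrix.mulVec, dotProduct, Fin.sum_univ_two] using congrFun hz 0
  refine ⟨h01, ?_⟩
  rw [← hA.isHermitian.apply 1 0, h01, star_zero]

/-- The four qubit states `|0⟩⟨0|, |1⟩⟨1|, |+⟩⟨+|, |−⟩⟨−|` satisfy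
`ρ₁ + ρ₂ = ρ₃ + ρ₄ = I`, are linearly dependent, and are Spekkens contextual. -/
theorem bb84_states_contextual :
    ∀ (v0 v1 vp vm : Fin 2 → ℂ),
      v0 = ![1, 0] →
      v1 = ![0, 1] →
      vp = ![(Real.sqrt 2 : ℂ)⁻¹, (Real.sqrt 2 : ℂ)⁻¹] →
      vm = ![(Real.sqrt 2 : ℂ)⁻¹, -(Real.sqrt 2 : ℂ)⁻¹] →
      ∀ ρ : Fin 4 → Matrix (Fin 2) (Fin 2) ℂ,
        ρ = ![Matrix.vecMulVec v0 (star v0), Matrix.vecMulVec v1 (star v1),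
              Matrix.vecMulVec vp (star vp), Matrix.vecMulVec vm (star vm)] →
        (ρ 0 + ρ 1 = 1 ∧ ρ 2 + ρ 3 = 1) ∧
        ¬ LinearIndependent ℂ ρ ∧
        ¬ SpekkensNoncontextual ρ := by
  rintro v0 v1 vp vm rfl rfl hp hm ρ rfl
  have hs : (Real.sqrt 2 : ℂ)⁻¹ * (Real.sqrt 2 : ℂ)⁻¹ = 1 / 2 := by
    rw [← mul_inv, ← Complex.ofReal_mul, Real.mul_self_sqrt (by norm_num)]
    norm_num
  have e0 : Matrix.vecMulVec ![1, 0] (star ![1, 0]) = (!![1, 0; 0, 0] : Matrix _ _ ℂ) := by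
    ext i j; fin_cases i <;> fin_cases j <;> simp [Matrix.vecMulVec_apply]
  have e1 : Matrix.vecMulVec ![0, 1] (star ![0, 1]) = (!![0, 0; 0, 1] : Matrix _ _ ℂ) := by
    ext i j; fin_cases i <;> fin_cases j <;> simp [Matrix.vecMulVec_apply]
  have ep : Matrix.vecMulVec vp (star vp) = !![1 / 2, 1 / 2; 1 / 2, 1 / 2] := by
    rw [hp, ← hs]
    ext i j; fin_cases i <;> fin_cases j <;> simp [Matrix.vecMulVec_apply]
  have em : Matrix.vecMulVec vm (star vm) = !![1 / 2, -(1 / 2); -(1 / 2), 1 / 2] := by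
    rw [hm, ← hs]
    ext i j; fin_cases i <;> fin_cases j <;> simp [Matrix.vecMulVec_apply]
  have q1 := fun {A : Matrix (Fin 2) (Fin 2) ℂ} (hA : A.PosSemidef) =>
    trace_mul_vecMulVec_star_nonneg hA ![0, 1]
  have qp := fun {A : Matrix (Fin 2) (Fin 2) ℂ} (hA : A.PosSemidef) =>
    trace_mul_vecMulVec_star_nonneg hA vp
  have qm := fun {A : Matrix (Fin 2) (Fin 2) ℂ} (hA : A.PosSemidef) =>
    trace_mul_vecMulVec_star_nonneg hA vm
  have p1 := Matrix.posSemidef_vecMulVec_self_star (R := ℂ) ![(0 : ℂ), 1]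
  have pp := Matrix.posSemidef_vecMulVec_self_star vp
  have pm := Matrix.posSemidef_vecMulVec_self_star vm
  rw [e1] at q1 p1
  rw [ep] at qp pp
  rw [em] at qm pm
  rw [e0, e1, ep, em]
  refine ⟨⟨?_, ?_⟩, ?_, ?_⟩
  · ext i j; fin_cases i <;> fin_cases j <;> simp
  · ext i j; fin_cases i <;> fin_cases j <;> simp <;> norm_num
  · intro hli
    have h := Fintype.linearIndependent_iff.1 hli ![1, 1, -1, -1] (by
      ext i j; fin_cases i <;> fin_cases j <;> simp [Fin.sum_univ_four] <;> norm_num) 0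
    simp at h
  · rintro ⟨L, G, σ, -, -, hσ, hpos, hM⟩
    have key : ∀ l, ((!![1, 0; 0, 0] : Matrix (Fin 2) (Fin 2) ℂ) * G l).trace = 0 := by
      intro l
      have h0 := trace_mul_trace_eq_zero (hpos 0) (fun l => q1 (hσ l).1) (hM _ p1 0)
        (by simp [Matrix.trace_fin_two]) l
      have h2 := trace_mul_trace_eq_zero (hpos 2) (fun l => qm (hσ l).1) (hM _ pm 2)
        (by simp [Matrix.trace_fin_two]) l
      have h3 := trace_mul_trace_eq_zero (hpos 3) (fun l => qp (hσ l).1) (hM _ pp 3)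
        (by simp [Matrix.trace_fin_two]) l
      have n0 := hpos 0 l
      have n1 := hpos 1 l
      have ht := (hσ l).2
      rcases mul_eq_zero.1 h0 with h | h
      · exact h
      have h11 : σ l 1 1 = 0 := by
        simpa [Matrix.trace_fin_two, Matrix.mul_apply, Fin.sum_univ_two] using h
      obtain ⟨h01, h10⟩ := (hσ l).1.offDiag_eq_zero h11
      have h00 : σ l 0 0 = 1 := by simpa [Matrix.trace_fin_two, h11] using ht
      simp [Matrix.trace_fin_two, Matrix.mul_apply, Matrix.vecMul, dotProduct, h00, h01, h10, h11]
        at h2 h3 n0 n1 ⊢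
      have hsum : G l 0 0 + G l 1 1 = 0 := by linear_combination h2 + h3
      exact ((add_eq_zero_iff_of_nonneg n0 n1).1 hsum).1
    have h := hM 1 Matrix.PosSemidef.one 0
    simp [Matrix.trace_fin_two] at h key
    simp [key] at h
end

section
/- Let m > 0, p ≥ 0, and θ, ζ ∈ ℝ. Set E = √(m² + p²) and E′ = E·cosh(ζ) + p·cos(θ)·sinh(ζ). Define α = √((E+m)/(E′+m)) · [cosh(ζ/2) + (p·cos(θ)/(E+m))·sinh(ζ/2)] and β = p·sin(θ)·sinh(ζ/2)/√((E+m)(E′+m)). Then α² + β² = 1. (In particular E′ + m > 0, so α and β are well defined.) -/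
/-- The entries `α, β` of the spin-1/2 Wigner rotation matrix for a boost of rapidity `ζ`
along the `z`-axis satisfy `α² + β² = 1`; in particular `E' + m > 0` so they are
well defined. -/
theorem wigner_entries_sq_add_sq (m p θ ζ E E' α β : ℝ) (hm : 0 < m) (hp : 0 ≤ p)
    (hE : E = Real.sqrt (m ^ 2 + p ^ 2))
    (hE' : E' = E * Real.cosh ζ + p * Real.cos θ * Real.sinh ζ)
    (hα : α = Real.sqrt ((E + m) / (E' + m)) *
      (Real.cosh (ζ / 2) + p * Real.cos θ / (E + m) * Real.sinh (ζ / 2)))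
    (hβ : β = p * Real.sin θ * Real.sinh (ζ / 2) / Real.sqrt ((E + m) * (E' + m))) :
    0 < E' + m ∧ α ^ 2 + β ^ 2 = 1 := by
  have hE0 : 0 ≤ E := hE ▸ Real.sqrt_nonneg _
  have hE2 : E ^ 2 = m ^ 2 + p ^ 2 := by rw [hE, Real.sq_sqrt (by positivity)]
  have hEm : 0 < E + m := by linarith
  have hcosh : Real.cosh ζ = Real.cosh (ζ / 2) ^ 2 + Real.sinh (ζ / 2) ^ 2 := by
    rw [← Real.cosh_two_mul]; ring_nf
  have hsinh : Real.sinh ζ = 2 * Real.sinh (ζ / 2) * Real.cosh (ζ / 2) := by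
    rw [← Real.sinh_two_mul]; ring_nf
  have hCS := Real.cosh_sq_sub_sinh_sq (ζ / 2)
  have hC := Real.cosh_pos (ζ / 2)
  have hcs := Real.sin_sq_add_cos_sq θ
  rw [hcosh, hsinh] at hE'
  generalize Real.cosh (ζ / 2) = C at *
  generalize Real.sinh (ζ / 2) = S at *
  generalize Real.cos θ = c at *
  generalize Real.sin θ = s at *
  have key : (E + m) * (E' + m) = ((E + m) * C + p * c * S) ^ 2 + (p * s * S) ^ 2 := by
    rw [hE']
    linear_combination (-(E + m) * m) * hCS - p ^ 2 * S ^ 2 * hcs + S ^ 2 * hE2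
  have hlt : 0 < (E + m) * C + p * c * S := by
    have hpE : p ^ 2 < (E + m) ^ 2 := by nlinarith [mul_nonneg hE0 hm.le]
    have hcS : (c * S) ^ 2 ≤ C ^ 2 := by nlinarith [mul_nonneg (sq_nonneg s) (sq_nonneg S)]
    have hsq : (p * c * S) ^ 2 < ((E + m) * C) ^ 2 := calc
      (p * c * S) ^ 2 = p ^ 2 * (c * S) ^ 2 := by ring
      _ ≤ p ^ 2 * C ^ 2 := by gcongr
      _ < (E + m) ^ 2 * C ^ 2 := by gcongr
      _ = ((E + m) * C) ^ 2 := by ring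
    linarith [(abs_lt_of_sq_lt_sq' hsq (by positivity)).1]
  have hpos : 0 < E' + m := by
    refine pos_of_mul_pos_right ?_ hEm.le
    rw [key]
    positivity
  refine ⟨hpos, ?_⟩
  rw [hα, hβ, mul_pow, div_pow, Real.sq_sqrt (by positivity), Real.sq_sqrt (by positivity)]
  field_simp
  linear_combination -key
end

section
/- Let m > 0, p ≥ 0, and θ, φ, ζ ∈ ℝ. Set E = √(m² + p²), E′ = E·cosh(ζ) + p·cos(θ)·sinh(ζ), α = √((E+m)/(E′+m)) · [cosh(ζ/2) + (p·cos(θ)/(E+m))·sinh(ζ/2)], and β = p·sin(θ)·sinh(ζ/2)/√((E+m)(E′+m)). Then the 2×2 complex matrix D with rows (α, β·e^{−iφ}) and (−β·e^{iφ}, α) is unitary and has determinant 1 (i.e. D ∈ SU(2)). -/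
/-- A matrix `!![a, b e^{-ix}; -b e^{ix}, a]` with `a`, `b`, `x` real and `a ^ 2 + b ^ 2 = 1`
is unitary with determinant `1`. -/
lemma mem_unitaryGroup_and_det_eq_one_of_sq_add_sq {a b : ℝ} (h : a ^ 2 + b ^ 2 = 1) (x : ℝ) :
    !![(a : ℂ), (b : ℂ) * Complex.exp (-(Complex.I * (x : ℂ)));
       -(b : ℂ) * Complex.exp (Complex.I * (x : ℂ)), (a : ℂ)] ∈ Matrix.unitaryGroup (Fin 2) ℂ ∧
    !![(a : ℂ), (b : ℂ) * Complex.exp (-(Complex.I * (x : ℂ)));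
       -(b : ℂ) * Complex.exp (Complex.I * (x : ℂ)), (a : ℂ)].det = 1 := by
  have hab : (a : ℂ) ^ 2 + (b : ℂ) ^ 2 = 1 := mod_cast h
  have hexp : Complex.exp (Complex.I * x) * Complex.exp (-(Complex.I * x)) = 1 := by
    rw [← Complex.exp_add, add_neg_cancel, Complex.exp_zero]
  constructor
  · rw [Matrix.mem_unitaryGroup_iff, Matrix.star_eq_conjTranspose]
    ext i j
    fin_cases i <;> fin_cases j <;>
      simp [Matrix.mul_apply, Fin.sum_univ_two, ← Complex.exp_conj] <;> grind
  · rw [Matrix.det_fin_two_of]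
    linear_combination hab + (b : ℂ) ^ 2 * hexp

/-- If `|x| ≤ E`, then boosting `(E, x)` by rapidity `ζ` yields a nonnegative energy. -/
lemma boosted_energy_nonneg {E x : ℝ} (h : |x| ≤ E) (ζ : ℝ) :
    0 ≤ E * Real.cosh ζ + x * Real.sinh ζ := by
  obtain ⟨h₁, h₂⟩ := abs_le.mp h
  have hadd : 0 ≤ Real.cosh ζ + Real.sinh ζ := by
    rw [Real.cosh_add_sinh]; positivity
  have hsub : 0 ≤ Real.cosh ζ - Real.sinh ζ := by
    rw [Real.cosh_sub_sinh]; positivity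
  nlinarith [mul_nonneg (by linarith : 0 ≤ E + x) hadd, mul_nonneg (sub_nonneg.mpr h₂) hsub]

/-- The spin-1/2 Wigner rotation matrix
`D = !![α, β e^{-iφ}; -β e^{iφ}, α]` associated with a Lorentz boost of rapidity `ζ`
along the `z`-axis is unitary with determinant `1`, i.e. `D ∈ SU(2)`. -/
theorem wigner_matrix_mem_SU2 (m p θ φ ζ E E' α β : ℝ) (hm : 0 < m) (hp : 0 ≤ p)
    (hE : E = Real.sqrt (m ^ 2 + p ^ 2))
    (hE' : E' = E * Real.cosh ζ + p * Real.cos θ * Real.sinh ζ)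
    (hα : α = Real.sqrt ((E + m) / (E' + m)) *
      (Real.cosh (ζ / 2) + p * Real.cos θ / (E + m) * Real.sinh (ζ / 2)))
    (hβ : β = p * Real.sin θ * Real.sinh (ζ / 2) / Real.sqrt ((E + m) * (E' + m)))
    (D : Matrix (Fin 2) (Fin 2) ℂ)
    (hD : D = !![(α : ℂ), (β : ℂ) * Complex.exp (-(Complex.I * (φ : ℂ)));
                 -(β : ℂ) * Complex.exp (Complex.I * (φ : ℂ)), (α : ℂ)]) :
    D ∈ Matrix.unitaryGroup (Fin 2) ℂ ∧ D.det = 1 := by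
  have hE2 : E ^ 2 = m ^ 2 + p ^ 2 := by rw [hE, Real.sq_sqrt (by positivity)]
  have hpE : p ≤ E := hE ▸ Real.le_sqrt_of_sq_le (by nlinarith)
  have hEm : 0 < E + m := by linarith
  have hpcos : |p * Real.cos θ| ≤ E := by
    rw [abs_mul, abs_of_nonneg hp]
    exact (mul_le_of_le_one_right hp (Real.abs_cos_le_one θ)).trans hpE
  have hEm' : 0 < E' + m := by linarith [boosted_energy_nonneg hpcos ζ]
  have hcosh : Real.cosh ζ = Real.cosh (ζ / 2) ^ 2 + Real.sinh (ζ / 2) ^ 2 := by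
    rw [← Real.cosh_two_mul, mul_div_cancel₀ ζ two_ne_zero]
  have hsinh : Real.sinh ζ = 2 * Real.sinh (ζ / 2) * Real.cosh (ζ / 2) := by
    rw [← Real.sinh_two_mul, mul_div_cancel₀ ζ two_ne_zero]
  have hαβ : α ^ 2 + β ^ 2 = 1 := by
    rw [hα, hβ, mul_pow, div_pow, Real.sq_sqrt (by positivity), Real.sq_sqrt (by positivity)]
    field_simp
    rw [hE', hcosh, hsinh]
    linear_combination p ^ 2 * Real.sinh (ζ / 2) ^ 2 * Real.sin_sq_add_cos_sq θ
      - Real.sinh (ζ / 2) ^ 2 * hE2 + m * (E + m) * Real.cosh_sq_sub_sinh_sq (ζ / 2)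
  rw [hD]
  exact mem_unitaryGroup_and_det_eq_one_of_sq_add_sq hαβ φ
end
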